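/- Let d be a natural number, fix a format n : Fin d → ℕ, and let f be a function from d-way complex tensors of format n to the nonnegative reals satisfying f(σT) = f(T) for every tensor T and every field automorphism σ of ℂ. Then f(T) depends only on the ideal of rational polynomial relations among the entries of T: for all tensors T and T' of format n with I(T) = I(T'), one has f(T) = f(T'). -/

import Mathlib

open Cardinal in
/-- Two uncountable equipotent algebraically closed extensions of a countable domain are
isomorphic as algebras over it. -/
theorem IsAlgClosed.nonempty_algEquiv_of_countable {R K L : Type*} [CommRing R] [Countable R]
    [Field K] [Field L] [IsAlgClosed K] [IsAlgClosed L] [Algebra R K] [Algebra R L]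
    [FaithfulSMul R K] [FaithfulSMul R L] (hK : ℵ₀ < #K) (hKL : Nonempty (K ≃ L)) :
    Nonempty (K ≃ₐ[R] L) := by
  have : Nontrivial R := RingHom.domain_nontrivial (algebraMap R K)
  have hR : #R ≤ ℵ₀ := mk_le_aleph0
  obtain ⟨s, hs⟩ := exists_isTranscendenceBasis R K
  obtain ⟨t, ht⟩ := exists_isTranscendenceBasis R L
  have hL : ℵ₀ < #L := by
    rwa [← aleph0_lt_lift, ← lift_mk_eq'.2 hKL, aleph0_lt_lift]
  have hsK := lift_injective (cardinal_eq_cardinal_transcendence_basis_of_aleph0_lt _ hs hR hK)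
  have htL := lift_injective (cardinal_eq_cardinal_transcendence_basis_of_aleph0_lt _ ht hR hL)
  obtain ⟨e⟩ := lift_mk_eq'.1 (hsK ▸ htL ▸ lift_mk_eq'.2 hKL)
  have := isAlgClosure_of_transcendence_basis _ hs
  have := isAlgClosure_of_transcendence_basis _ ht
  let g := hs.1.aevalEquiv.symm.trans ((MvPolynomial.renameEquiv R e).trans ht.1.aevalEquiv)
  refine ⟨AlgEquiv.ofRingEquiv (f := IsAlgClosure.equivOfEquiv K L g.toRingEquiv) fun r ↦ ?_⟩
  rw [IsScalarTower.algebraMap_apply R (Algebra.adjoin R (Set.range ((↑) : s → K))) K,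
    IsAlgClosure.equivOfEquiv_algebraMap]
  change algebraMap _ L (g _) = _
  rw [g.commutes, ← IsScalarTower.algebraMap_apply]

/-- Two embeddings of a countable ring into `ℂ` differ by an automorphism of `ℂ`. -/
theorem Complex.exists_ringEquiv_comp_eq {R : Type*} [CommRing R] [Countable R]
    {φ ψ : R →+* ℂ} (hφ : Function.Injective φ) (hψ : Function.Injective ψ) :
    ∃ σ : ℂ ≃+* ℂ, ∀ r, σ (φ r) = ψ r := by
  have hC : Cardinal.aleph0 < Cardinal.mk ℂ := by
    rw [Cardinal.mk_complex]
    exact Cardinal.aleph0_lt_continuum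
  obtain ⟨σ⟩ := @IsAlgClosed.nonempty_algEquiv_of_countable R ℂ ℂ _ _ _ _ _ _
    φ.toAlgebra ψ.toAlgebra
    (letI := φ.toAlgebra; (faithfulSMul_iff_algebraMap_injective R ℂ).2 hφ)
    (letI := ψ.toAlgebra; (faithfulSMul_iff_algebraMap_injective R ℂ).2 hψ) hC ⟨Equiv.refl ℂ⟩
  exact ⟨@AlgEquiv.toRingEquiv R ℂ ℂ _ _ _ φ.toAlgebra ψ.toAlgebra σ,
    @AlgEquiv.commutes R ℂ ℂ _ _ _ φ.toAlgebra ψ.toAlgebra σ⟩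

/-- Families of complex numbers satisfying the same rational polynomial relations are conjugate
under an automorphism of `ℂ`. -/
theorem Complex.exists_ringEquiv_apply_eq_of_aeval_eq_zero_iff {ι : Type*} [Countable ι]
    {x y : ι → ℂ}
    (h : ∀ p : MvPolynomial ι ℚ, MvPolynomial.aeval x p = 0 ↔ MvPolynomial.aeval y p = 0) :
    ∃ σ : ℂ ≃+* ℂ, ∀ i, σ (x i) = y i := by
  let I := RingHom.ker (MvPolynomial.aeval (R := ℚ) x).toRingHom
  have hI : I = RingHom.ker (MvPolynomial.aeval (R := ℚ) y).toRingHom := by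
    ext p
    exact h p
  have : Countable (MvPolynomial ι ℚ) := by
    rw [← Cardinal.mk_le_aleph0_iff]
    exact MvPolynomial.cardinalMk_le_max_lift.trans (by simp)
  have : Countable (MvPolynomial ι ℚ ⧸ I) := Ideal.Quotient.mk_surjective.countable
  obtain ⟨σ, hσ⟩ := Complex.exists_ringEquiv_comp_eq
    (φ := Ideal.Quotient.lift I (MvPolynomial.aeval (R := ℚ) x).toRingHom fun _ ↦ id)
    (ψ := Ideal.Quotient.lift I (MvPolynomial.aeval (R := ℚ) y).toRingHom fun p ↦ (h p).1)
    (RingHom.lift_injective_of_ker_le_ideal _ _ le_rfl)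
    (RingHom.lift_injective_of_ker_le_ideal _ _ hI.ge)
  refine ⟨σ, fun i ↦ ?_⟩
  simpa using hσ (Ideal.Quotient.mk I (MvPolynomial.X i))

/-- an algebraic invariant `f` of `d`-way complex tensors of format `n`
depends only on the ideal of rational polynomial relations among the entries: if
`I(T) = I(T')` then `f T = f T'`. -/
theorem invariant_depends_only_on_relations (d : ℕ) (n : Fin d → ℕ)
    (f : (((i : Fin d) → Fin (n i)) → ℂ) → NNReal)
    (hf : ∀ (T : ((i : Fin d) → Fin (n i)) → ℂ) (σ : ℂ ≃+* ℂ),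
      f (fun α => σ (T α)) = f T)
    (T T' : ((i : Fin d) → Fin (n i)) → ℂ)
    (h : ∀ p : MvPolynomial ((i : Fin d) → Fin (n i)) ℚ,
      MvPolynomial.aeval T p = 0 ↔ MvPolynomial.aeval T' p = 0) :
    f T = f T' := by
  obtain ⟨σ, hσ⟩ := Complex.exists_ringEquiv_apply_eq_of_aeval_eq_zero_iff h
  rw [← hf T σ, funext hσ]
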